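/- arXiv:1309.3731 — 4 statements merged into one kernel-verified Lean document; each statement's English description precedes it below -/
import Mathlib

section
/- Let (z_n)_{n≥1} be a greedy sequence for u, i.e. z_n ∈ D for all n and, setting u_0 = 0 and u_n = u_{n−1} + z_n, for every n ≥ 1 the element z_n realizes the infimum: ‖u − u_{n−1} − z_n‖ = inf_{z ∈ D} ‖u − u_{n−1} − z‖. Then ‖u_n − u‖ → 0 as n → ∞. -/
lemma aux_liminf (a : ℕ → ℝ) (ha : ∀ n, 0 ≤ a n) (C : ℝ)
    (hC : ∀ n, ∑ k ∈ Finset.range n, a k ^ 2 ≤ C) (ε : ℝ) (hε : 0 < ε) (N : ℕ) :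
    ∃ m ≥ N, a m * ∑ k ∈ Finset.range (m + 1), a k < ε := by
  by_contra! h
  have hC0 : 0 ≤ C := by simpa using hC 0
  have hsum : Summable (fun n => a n ^ 2) :=
    summable_of_sum_range_le (fun n => sq_nonneg _) hC
  have key : ∀ m ≥ N, ε ^ 2 / (C + 1) * (1 / ((m : ℝ) + 1)) ≤ a m ^ 2 := by
    intro m hm
    have h1 := h m hm
    have h2 : (∑ k ∈ Finset.range (m + 1), a k) ^ 2 ≤ ((m : ℝ) + 1) * (C + 1) := by
      have h3 := sq_sum_le_card_mul_sum_sq (s := Finset.range (m + 1)) (f := a)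
      simp only [Finset.card_range] at h3
      push_cast at h3
      refine h3.trans ?_
      have := hC (m + 1)
      gcongr
      linarith
    have h4 : ε ^ 2 ≤ a m ^ 2 * (∑ k ∈ Finset.range (m + 1), a k) ^ 2 := by
      rw [← mul_pow]; gcongr
    have h5 : ε ^ 2 ≤ a m ^ 2 * (((m : ℝ) + 1) * (C + 1)) :=
      h4.trans (mul_le_mul_of_nonneg_left h2 (sq_nonneg _))
    rw [div_mul_div_comm, mul_one, div_le_iff₀ (by positivity)]
    linarith
  have s1 : Summable (fun n => a (n + N) ^ 2) := (summable_nat_add_iff N).2 hsum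
  have s2 : Summable (fun n : ℕ => ε ^ 2 / (C + 1) * (1 / (((n + N : ℕ) : ℝ) + 1))) :=
    Summable.of_nonneg_of_le (fun n => by positivity) (fun n => key (n + N) (by omega)) s1
  have hne : ε ^ 2 / (C + 1) ≠ 0 := by positivity
  have s3 := (summable_mul_left_iff hne).1 s2
  have s4 : Summable (fun n : ℕ => 1 / ((n : ℝ) + 1)) :=
    (summable_nat_add_iff (f := fun n : ℕ => 1 / ((n : ℝ) + 1)) N).1 s3
  have s5 : Summable (fun n : ℕ => 1 / (n : ℝ)) :=
    (summable_nat_add_iff (f := fun n : ℕ => 1 / (n : ℝ)) 1).1 (by simpa using s4)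
  exact Real.not_summable_one_div_natCast s5


/-- Convergence of the pure greedy algorithm in a real Hilbert space `V`:
if `D ⊆ V` is nonempty, stable by multiplication by arbitrary real scalars, with dense
linear span, and `(z n)` is a greedy sequence for `u` (each `z n` realizes the infimum of
`‖u - uₙ₋₁ - z‖` over `z ∈ D`, where `uₙ = z 0 + ⋯ + z (n-1)`), then `‖uₙ - u‖ → 0`. -/
theorem greedy_convergence
    {V : Type*} [NormedAddCommGroup V] [InnerProductSpace ℝ V] [CompleteSpace V]
    (D : Set V) (hD : D.Nonempty)
    (hscal : ∀ (lam : ℝ) (z : V), z ∈ D → lam • z ∈ D)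
    (hdense : Dense (Submodule.span ℝ D : Set V))
    (u : V) (z : ℕ → V) (hzD : ∀ n, z n ∈ D)
    (hgreedy : ∀ n : ℕ,
      ‖u - (∑ k ∈ Finset.range n, z k) - z n‖ =
        sInf ((fun w => ‖u - (∑ k ∈ Finset.range n, z k) - w‖) '' D)) :
    Filter.Tendsto (fun n : ℕ => ‖(∑ k ∈ Finset.range n, z k) - u‖)
      Filter.atTop (nhds 0) := by

  set r : ℕ → V := fun n => u - ∑ k ∈ Finset.range n, z k with hr
  have hrs : ∀ n, r (n + 1) = r n - z n := by
    intro n; simp only [hr, Finset.sum_range_succ]; abel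
  have h1 : ∀ n, ∀ w ∈ D, ‖r n - z n‖ ≤ ‖r n - w‖ := by
    intro n w hw
    have := hgreedy n
    simp only [hr]
    rw [this]
    exact csInf_le ⟨0, by rintro _ ⟨x, _, rfl⟩; exact norm_nonneg _⟩ ⟨w, hw, rfl⟩
  have h1' : ∀ n, ∀ w ∈ D, ∀ t : ℝ, ‖r n - z n‖ ^ 2 ≤
      ‖r n‖ ^ 2 - 2 * t * inner ℝ (r n) w + t ^ 2 * ‖w‖ ^ 2 := by
    intro n w hw t
    have h := pow_le_pow_left₀ (norm_nonneg _) (h1 n _ (hscal t w hw)) 2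
    rw [norm_sub_sq_real (r n) (t • w), real_inner_smul_right, norm_smul, mul_pow,
      Real.norm_eq_abs, sq_abs] at h
    linarith
  have h2 : ∀ n, inner ℝ (r n) (z n) = ‖z n‖ ^ 2 := by
    intro n
    have h : ∀ t : ℝ, 0 ≤ ‖z n‖ ^ 2 * (t * t) + (- 2 * inner ℝ (r n) (z n)) * t
        + (2 * inner ℝ (r n) (z n) - ‖z n‖ ^ 2) := by
      intro t
      have := h1' n _ (hzD n) t
      rw [norm_sub_sq_real] at this
      linarith
    have := discrim_le_zero h
    unfold discrim at this
    have h' : (inner ℝ (r n) (z n) - ‖z n‖ ^ 2) ^ 2 ≤ 0 := by linarith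
    have := pow_eq_zero_iff (two_ne_zero) |>.1 (le_antisymm h' (sq_nonneg _))
    linarith
  have h2' : ∀ n, ‖r (n + 1)‖ ^ 2 = ‖r n‖ ^ 2 - ‖z n‖ ^ 2 := by
    intro n; rw [hrs, norm_sub_sq_real, h2]; ring
  have h3 : ∀ n, ∀ w ∈ D, |inner ℝ (r n) w| ≤ ‖w‖ * ‖z n‖ := by
    intro n w hw
    have h : ∀ t : ℝ, 0 ≤ ‖w‖ ^ 2 * (t * t) + (- 2 * inner ℝ (r n) w) * t
        + ‖z n‖ ^ 2 := by
      intro t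
      have := h1' n w hw t
      rw [← hrs, h2'] at this
      linarith
    have := discrim_le_zero h
    unfold discrim at this
    apply abs_le_of_sq_le_sq _ (by positivity)
    linarith
  have h4 : ∀ n, ∑ k ∈ Finset.range n, ‖z k‖ ^ 2 = ‖r 0‖ ^ 2 - ‖r n‖ ^ 2 := by
    intro n
    induction n with
    | zero => simp
    | succ n ih => rw [Finset.sum_range_succ, ih, h2']; ring
  have h4' : ∀ n, ∑ k ∈ Finset.range n, ‖z k‖ ^ 2 ≤ ‖r 0‖ ^ 2 := by
    intro n; rw [h4]; nlinarith [sq_nonneg ‖r n‖]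
  have hsum : Summable (fun n => ‖z n‖ ^ 2) :=
    summable_of_sum_range_le (fun n => sq_nonneg _) h4'
  have hz0 : Filter.Tendsto (fun n => ‖z n‖) Filter.atTop (nhds 0) := by
    have := hsum.tendsto_atTop_zero.sqrt
    simpa using this
  have h5 : ∀ n m, n ≤ m → ‖r n - r m‖ ^ 2 ≤ ‖r n‖ ^ 2 - ‖r m‖ ^ 2
      + 2 * (‖z m‖ * ∑ k ∈ Finset.range (m + 1), ‖z k‖) := by
    intro n m hnm
    have e : r n - r m = ∑ k ∈ Finset.Ico n m, z k := by
      rw [Finset.sum_Ico_eq_sub _ hnm]; simp only [hr]; abel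
    have b : |inner ℝ (r m) (r n - r m)| ≤ ‖z m‖ * ∑ k ∈ Finset.range (m + 1), ‖z k‖ := by
      rw [e, inner_sum]
      refine (Finset.abs_sum_le_sum_abs _ _).trans ?_
      refine (Finset.sum_le_sum fun k _ => h3 m (z k) (hzD k)).trans ?_
      rw [← Finset.sum_mul, mul_comm]
      refine mul_le_mul_of_nonneg_left ?_ (norm_nonneg _)
      refine Finset.sum_le_sum_of_subset_of_nonneg ?_ (fun _ _ _ => norm_nonneg _)
      intro k hk
      simp only [Finset.mem_Ico, Finset.mem_range] at *
      omega
    have b' := neg_le_of_abs_le b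
    rw [inner_sub_right, real_inner_self_eq_norm_sq, real_inner_comm] at b'
    rw [norm_sub_sq_real]
    linarith
  have hanti : Antitone (fun n => ‖r n‖ ^ 2) :=
    antitone_nat_of_succ_le fun n => by rw [h2']; linarith [sq_nonneg ‖z n‖]
  have hconv := tendsto_atTop_ciInf hanti ⟨0, by rintro _ ⟨x, rfl⟩; positivity⟩
  set L := ⨅ n, ‖r n‖ ^ 2
  have hL : ∀ n, L ≤ ‖r n‖ ^ 2 := fun n =>
    ciInf_le ⟨0, by rintro _ ⟨x, rfl⟩; positivity⟩ n
  have hcau : CauchySeq r := by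
    rw [Metric.cauchySeq_iff]
    intro ε hε
    have hδ : 0 < (ε / 2) ^ 2 / 3 := by positivity
    obtain ⟨N, hN⟩ := Filter.eventually_atTop.1
      (hconv.eventually (gt_mem_nhds (show L < L + (ε / 2) ^ 2 / 3 by linarith)))
    refine ⟨N, fun m hm n hn => ?_⟩
    obtain ⟨M, hM, hM'⟩ := aux_liminf (fun n => ‖z n‖) (fun _ => norm_nonneg _) _ h4' _ hδ
      (max m n)
    have g : ∀ n ≥ N, n ≤ M → dist (r n) (r M) < ε / 2 := by
      intro n hn hnM
      rw [dist_eq_norm]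
      apply lt_of_pow_lt_pow_left₀ 2 (by positivity)
      have := h5 n M hnM
      have a := hN n hn
      have b := hL M
      linarith
    have g1 := g m hm ((le_max_left _ _).trans hM)
    have g2 := g n hn ((le_max_right _ _).trans hM)
    have := dist_triangle_right (r m) (r n) (r M)
    linarith
  obtain ⟨x, hx⟩ := cauchySeq_tendsto_of_complete hcau
  have hxD : ∀ w ∈ D, inner ℝ x w = 0 := by
    intro w hw
    have t1 : Filter.Tendsto (fun n => inner ℝ (r n) w) Filter.atTop (nhds (inner ℝ x w)) :=
      hx.inner tendsto_const_nhds
    have t2 : Filter.Tendsto (fun n => inner ℝ (r n) w) Filter.atTop (nhds 0) := by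
      refine squeeze_zero_norm (fun n => h3 n w hw) ?_
      simpa using hz0.const_mul ‖w‖
    exact tendsto_nhds_unique t1 t2
  have hx0 : x = 0 := by
    refine hdense.eq_zero_of_inner_left ℝ ?_
    intro v hv
    change inner ℝ x v = 0
    rw [SetLike.mem_coe] at hv
    induction hv using Submodule.span_induction with
    | mem w hw => exact hxD w hw
    | zero => simp
    | add a b _ _ ha hb => rw [inner_add_right, ha, hb, add_zero]
    | smul t a _ ha => rw [real_inner_smul_right, ha, mul_zero]
  rw [hx0] at hx
  have := hx.norm
  rw [norm_zero] at this
  refine this.congr fun n => ?_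
  simp only [hr]
  exact norm_sub_rev _ _
end

section
/- Assume moreover that u belongs to the class 𝒜¹, i.e. there exists a sequence (d_k)_{k≥1} in D with u = Σ_{k=1}^∞ d_k (the series converging in V) and Σ_{k=1}^∞ ‖d_k‖ < ∞. Let (z_n)_{n≥1} be a greedy sequence for u, i.e. z_n ∈ D for all n and, setting u_0 = 0 and u_n = u_{n−1} + z_n, for every n ≥ 1 the element z_n realizes the infimum: ‖u − u_{n−1} − z_n‖ = inf_{z ∈ D} ‖u − u_{n−1} − z‖. Then there exists a constant C > 0 such that ‖u_n − u‖ ≤ C n^{−1/6} for all n ∈ ℕ*. -/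
lemma quad_aux (S p : ℝ) (q : ℝ) (hS : 0 ≤ S) (hq : q = 0 → p = 0) (hq0 : 0 ≤ q)
    (h : ∀ t : ℝ, -S ≤ -(2 * t * p) + t ^ 2 * q) : p ^ 2 ≤ S * q := by
  rcases hq0.eq_or_lt with h0 | h0
  · rw [hq h0.symm, ← h0]; simp
  · have h1 := h (p / q)
    have h2 : -(2 * (p / q) * p) + (p / q) ^ 2 * q = -(p ^ 2 / q) := by
      field_simp; ring
    rw [h2] at h1
    have : p ^ 2 / q ≤ S := by linarith
    rwa [div_le_iff₀ h0] at this

lemma greedy_step {V : Type*} [NormedAddCommGroup V] [InnerProductSpace ℝ V]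
    (D : Set V) (hscal : ∀ (lam : ℝ) (z : V), z ∈ D → lam • z ∈ D)
    (r z : V) (hz : z ∈ D) (h : ‖r - z‖ = sInf ((fun w => ‖r - w‖) '' D)) :
    inner ℝ r z = ‖z‖ ^ 2 ∧ ∀ d ∈ D, |inner ℝ r d| ≤ ‖z‖ * ‖d‖ := by
  have hle : ∀ w ∈ D, ‖r - z‖ ≤ ‖r - w‖ := by
    intro w hw
    rw [h]
    exact csInf_le ⟨0, by rintro _ ⟨v, -, rfl⟩; exact norm_nonneg _⟩ ⟨w, hw, rfl⟩
  have hsq : ∀ w ∈ D, ∀ t : ℝ, -(2 * inner ℝ r z) + ‖z‖ ^ 2 ≤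
      -(2 * t * inner ℝ r w) + t ^ 2 * ‖w‖ ^ 2 := by
    intro w hw t
    have h1 := pow_le_pow_left₀ (norm_nonneg _) (hle _ (hscal t w hw)) 2
    rw [norm_sub_sq_real, norm_sub_sq_real, inner_smul_right, norm_smul, mul_pow,
      Real.norm_eq_abs, sq_abs] at h1
    linarith
  have hp : inner ℝ r z = ‖z‖ ^ 2 := by
    by_cases hz0 : z = 0
    · simp [hz0]
    have hpos : 0 < ‖z‖ ^ 2 := by positivity
    have h1 := hsq z hz (inner ℝ r z / ‖z‖ ^ 2)
    generalize (inner ℝ r z : ℝ) = p at *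
    generalize ‖z‖ ^ 2 = S at *
    have h2 : -(2 * (p / S) * p) + (p / S) ^ 2 * S = -(p ^ 2 / S) := by
      field_simp; ring
    rw [h2] at h1
    have h3 : p ^ 2 / S ≤ 2 * p - S := by linarith
    rw [div_le_iff₀ hpos] at h3
    have h4 : (p - S) ^ 2 = 0 := le_antisymm (by nlinarith) (sq_nonneg _)
    have := pow_eq_zero_iff (two_ne_zero) |>.1 h4
    linarith
  refine ⟨hp, fun d hd => ?_⟩
  refine abs_le_of_sq_le_sq ?_ (by positivity)
  rw [mul_pow]
  apply quad_aux _ _ _ (by positivity) _ (by positivity)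
  · intro t
    have := hsq d hd t
    rw [hp] at this
    linarith
  · intro h0
    have : d = 0 := by simpa using h0
    simp [this]

lemma rate_aux (a s B : ℕ → ℝ) (ha : ∀ n, 0 ≤ a n) (hs : ∀ n, 0 ≤ s n) (hB : ∀ n, 0 < B n)
    (h1 : ∀ n, a (n + 1) = a n - s n ^ 2) (h2 : ∀ n, B (n + 1) = B n + s n)
    (h3 : ∀ n, a n ≤ s n * B n) (n : ℕ) : n * a n ^ 3 ≤ (a 0 * B 0) ^ 2 := by
  have hAB : ∀ n, a n * B n ≤ a 0 * B 0 := by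
    intro n
    induction n with
    | zero => exact le_rfl
    | succ n ih =>
      refine le_trans ?_ ih
      rw [h1, h2]
      have e1 := mul_le_mul_of_nonneg_left (h3 n) (hs n)
      have e2 := pow_nonneg (hs n) 3
      nlinarith
  have hc : ∀ n : ℕ, n * (a n / B n ^ 2) ≤ 1 := by
    intro n
    induction n with
    | zero => simp
    | succ n ih =>
      have hBn := hB n
      have hc0 : 0 ≤ a n / B n ^ 2 := div_nonneg (ha n) (by positivity)
      have hstep : a (n + 1) / B (n + 1) ^ 2 ≤ a n / B n ^ 2 - (a n / B n ^ 2) ^ 2 := by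
        calc a (n + 1) / B (n + 1) ^ 2 ≤ a (n + 1) / B n ^ 2 := by
              apply div_le_div_of_nonneg_left (ha _) (by positivity)
              apply pow_le_pow_left₀ hBn.le
              rw [h2]; linarith [hs n]
          _ ≤ _ := by
              have e : a n / B n ≤ s n := by rw [div_le_iff₀ hBn]; exact h3 n
              have e2 := pow_le_pow_left₀ (div_nonneg (ha n) hBn.le) e 2
              have e3 : a n / B n ^ 2 - (a n / B n ^ 2) ^ 2
                  = (a n - (a n / B n) ^ 2) / B n ^ 2 := by field_simp
              rw [e3, h1]
              gcongr
      generalize a n / B n ^ 2 = c at *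
      push_cast
      have e4 := mul_le_mul_of_nonneg_left hstep (by positivity : (0:ℝ) ≤ (n:ℝ) + 1)
      refine e4.trans ?_
      rcases Nat.eq_zero_or_pos n with h0 | h0
      · subst h0
        norm_num
        nlinarith [sq_nonneg (c - 1)]
      · have hn : (1:ℝ) ≤ n := by exact_mod_cast h0
        have : c ≤ 1 := by nlinarith
        nlinarith [mul_nonneg (sub_nonneg.2 ih) (sub_nonneg.2 this), sq_nonneg c]
  have hBn := hB n
  calc (n:ℝ) * a n ^ 3 = n * (a n / B n ^ 2) * (a n * B n) ^ 2 := by field_simp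
    _ ≤ 1 * (a 0 * B 0) ^ 2 := by
      apply mul_le_mul (hc n) _ (by positivity) zero_le_one
      exact pow_le_pow_left₀ (mul_nonneg (ha n) hBn.le) (hAB n) 2
    _ = _ := one_mul _

/-- Rate of convergence of the pure greedy algorithm in a real Hilbert space `V`:
if `D ⊆ V` is nonempty, stable by multiplication by arbitrary real scalars, with dense
linear span, `u ∈ 𝒜¹` (i.e. `u = ∑ₖ dₖ` with `dₖ ∈ D` and `∑ₖ ‖dₖ‖ < ∞`), and `(z n)` is a
greedy sequence for `u`, then `‖uₙ - u‖ ≤ C n^{-1/6}` for some constant `C > 0`. -/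
theorem greedy_rate
    {V : Type*} [NormedAddCommGroup V] [InnerProductSpace ℝ V] [CompleteSpace V]
    (D : Set V) (hD : D.Nonempty)
    (hscal : ∀ (lam : ℝ) (z : V), z ∈ D → lam • z ∈ D)
    (hdense : Dense (Submodule.span ℝ D : Set V))
    (u : V)
    (hA1 : ∃ dseq : ℕ → V, (∀ k, dseq k ∈ D) ∧
      Filter.Tendsto (fun n : ℕ => ∑ k ∈ Finset.range n, dseq k) Filter.atTop (nhds u) ∧
      Summable (fun k => ‖dseq k‖))
    (z : ℕ → V) (hzD : ∀ n, z n ∈ D)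
    (hgreedy : ∀ n : ℕ,
      ‖u - (∑ k ∈ Finset.range n, z k) - z n‖ =
        sInf ((fun w => ‖u - (∑ k ∈ Finset.range n, z k) - w‖) '' D)) :
    ∃ C : ℝ, 0 < C ∧ ∀ n : ℕ, 1 ≤ n →
      ‖(∑ k ∈ Finset.range n, z k) - u‖ ≤ C * (n : ℝ) ^ (-(1 : ℝ) / 6) := by
  obtain ⟨d, hdD, hdu, hsum⟩ := hA1
  have hst := fun n => greedy_step D hscal _ _ (hzD n) (hgreedy n)
  set r : ℕ → V := fun n => u - ∑ k ∈ Finset.range n, z k with hr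
  have hst' : ∀ n, inner ℝ (r n) (z n) = ‖z n‖ ^ 2 ∧
      ∀ d ∈ D, |inner ℝ (r n) d| ≤ ‖z n‖ * ‖d‖ := hst
  set M : ℝ := ∑' k, ‖d k‖ with hM
  have hM0 : 0 ≤ M := tsum_nonneg fun _ => norm_nonneg _
  have key := rate_aux (fun n => ‖r n‖ ^ 2) (fun n => ‖z n‖)
    (fun n => M + 1 + ∑ k ∈ Finset.range n, ‖z k‖) (fun n => by positivity)
    (fun n => norm_nonneg _)
    (fun n => by
      have : 0 ≤ ∑ k ∈ Finset.range n, ‖z k‖ := Finset.sum_nonneg fun _ _ => norm_nonneg _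
      positivity)
    (fun n => by
      have : r (n + 1) = r n - z n := by simp only [hr, Finset.sum_range_succ]; abel
      simp only [this]
      rw [norm_sub_sq_real, (hst' n).1]; ring)
    (fun n => by simp only [Finset.sum_range_succ]; ring)
    (fun n => by
      have e1 : inner ℝ (r n) u ≤ ‖z n‖ * M := by
        have ht : Filter.Tendsto (fun m : ℕ => (inner ℝ (r n) (∑ k ∈ Finset.range m, d k) : ℝ))
            Filter.atTop (nhds (inner ℝ (r n) u)) := tendsto_const_nhds.inner hdu
        refine le_of_tendsto' ht fun m => ?_
        rw [inner_sum]
        calc ∑ k ∈ Finset.range m, (inner ℝ (r n) (d k) : ℝ)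
            ≤ ∑ k ∈ Finset.range m, ‖z n‖ * ‖d k‖ :=
              Finset.sum_le_sum fun k _ => (le_abs_self _).trans ((hst' n).2 _ (hdD k))
          _ = ‖z n‖ * ∑ k ∈ Finset.range m, ‖d k‖ := by rw [Finset.mul_sum]
          _ ≤ ‖z n‖ * M := mul_le_mul_of_nonneg_left
              (hsum.sum_le_tsum _ fun _ _ => norm_nonneg _) (norm_nonneg _)
      have e2 : -(inner ℝ (r n) (∑ k ∈ Finset.range n, z k) : ℝ)
          ≤ ‖z n‖ * ∑ k ∈ Finset.range n, ‖z k‖ := by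
        rw [inner_sum, ← Finset.sum_neg_distrib, Finset.mul_sum]
        exact Finset.sum_le_sum fun k _ => (neg_le_abs _).trans ((hst' n).2 _ (hzD k))
      have e3 : ‖r n‖ ^ 2 = inner ℝ (r n) u - inner ℝ (r n) (∑ k ∈ Finset.range n, z k) := by
        rw [← inner_sub_right, ← real_inner_self_eq_norm_sq]
      have e4 := norm_nonneg (z n)
      simp only [e3]
      nlinarith)
  generalize (‖r 0‖ ^ 2 * (M + 1 + ∑ k ∈ Finset.range 0, ‖z k‖)) = K at key
  refine ⟨(K ^ 2 + 1) ^ ((1:ℝ) / 6), by positivity, fun n hn => ?_⟩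
  have hn0 : (0:ℝ) < n := by exact_mod_cast hn
  have hk := key n
  rw [norm_sub_rev]
  change ‖r n‖ ≤ _
  have h6 : ‖r n‖ ^ 6 ≤ (K ^ 2 + 1) / n := by
    rw [le_div_iff₀ hn0]
    nlinarith
  calc ‖r n‖ = (‖r n‖ ^ (6:ℕ)) ^ ((1:ℝ) / 6) := by
        rw [← Real.rpow_natCast, ← Real.rpow_mul (norm_nonneg _)]; norm_num
    _ ≤ ((K ^ 2 + 1) / n) ^ ((1:ℝ) / 6) :=
        Real.rpow_le_rpow (by positivity) h6 (by norm_num)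
    _ = _ := by
        rw [Real.div_rpow (by positivity) hn0.le, neg_div, Real.rpow_neg hn0.le, div_eq_mul_inv]
end

section
/- The tuple (r¹,…,r^d) satisfies the Euler equation: for all test functions (s¹,…,s^d) ∈ L²(Ω_1)×…×L²(Ω_d), ∫_{Ω_1×…×Ω_d} (∏_{j=1}^d r^j(x_j)) · (Σ_{i=1}^d s^i(x_i) ∏_{j≠i} r^j(x_j)) dx = ∫_{Ω_1×…×Ω_d} g(x) · (Σ_{i=1}^d s^i(x_i) ∏_{j≠i} r^j(x_j)) dx, if and only if for every i ∈ {1,…,d} the following holds for almost every x_i ∈ Ω_i: (∏_{j≠i} ‖r^j‖²_{L²(Ω_j)}) · r^i(x_i) = ∫_{∏_{j≠i} Ω_j} (∏_{j≠i} r^j(x_j)) g(x_1,…,x_d) ∏_{j≠i} dx_j. -/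
open MeasureTheory

lemma eec_memLp_prod {ι : Type*} [Fintype ι] (μ : ι → Measure ℝ) [∀ i, IsFiniteMeasure (μ i)]
    (f : ι → ℝ → ℝ) (hf : ∀ i, MemLp (f i) 2 (μ i)) :
    MemLp (fun x : ι → ℝ => ∏ j, f j (x j)) 2 (Measure.pi μ) := by
  have h1 : Integrable (fun x : ι → ℝ => ∏ j, f j (x j)) (Measure.pi μ) :=
    Integrable.fintype_prod (fun i => (hf i).integrable (by norm_num))
  rw [memLp_two_iff_integrable_sq h1.aestronglyMeasurable]
  have h2 : Integrable (fun x : ι → ℝ => ∏ j, (f j (x j)) ^ 2) (Measure.pi μ) :=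
    Integrable.fintype_prod (f := fun j t => (f j t) ^ 2) (fun i => (hf i).integrable_sq)
  simpa [Finset.prod_pow] using h2

lemma eec_mp {d : ℕ} (μ : Fin d → Measure ℝ) [∀ i, IsFiniteMeasure (μ i)] (i : Fin d) :
    MeasurePreserving (fun (p : ℝ × ({j : Fin d // j ≠ i} → ℝ)) (j : Fin d) =>
      if h : j = i then p.1 else p.2 ⟨j, h⟩)
      ((μ i).prod (Measure.pi fun j : {j : Fin d // j ≠ i} => μ j)) (Measure.pi μ) := by
  have hm : Measurable (fun (p : ℝ × ({j : Fin d // j ≠ i} → ℝ)) (j : Fin d) =>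
      if h : j = i then p.1 else p.2 ⟨j, h⟩) := by
    refine measurable_pi_lambda _ fun j => ?_
    by_cases h : j = i
    · simp only [h, dite_true]; exact measurable_fst
    · simp only [h, dite_false]; exact (measurable_pi_apply _).comp measurable_snd
  refine ⟨hm, ?_⟩
  symm
  apply Measure.pi_eq
  intro s hs
  rw [Measure.map_apply hm (MeasurableSet.univ_pi hs)]
  have : (fun (p : ℝ × ({j : Fin d // j ≠ i} → ℝ)) (j : Fin d) =>
      if h : j = i then p.1 else p.2 ⟨j, h⟩) ⁻¹' (Set.univ.pi s)
      = s i ×ˢ (Set.univ.pi fun j : {j : Fin d // j ≠ i} => s j) := by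
    ext p
    simp only [Set.mem_preimage, Set.mem_pi, Set.mem_univ, true_imp_iff, Set.mem_prod]
    constructor
    · intro h
      refine ⟨by simpa using h i, fun j => ?_⟩
      have := h j
      simpa [j.2] using this
    · rintro ⟨h1, h2⟩ j
      by_cases h : j = i
      · subst h; simpa using h1
      · simpa [h] using h2 ⟨j, h⟩
  rw [this, Measure.prod_prod, Measure.pi_pi, ← Finset.mul_prod_erase _ _ (Finset.mem_univ i)]
  congr 1
  rw [← Finset.prod_subtype (Finset.univ.erase i) (by simp) (fun j => μ j (s j))]

lemma eec_upd {d : ℕ} (r : Fin d → ℝ → ℝ) (i : Fin d) (s : ℝ → ℝ) (x : Fin d → ℝ) :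
    ∏ j, (Function.update r i s) j (x j) = s (x i) * ∏ j ∈ Finset.univ.erase i, r j (x j) := by
  rw [← Finset.mul_prod_erase _ _ (Finset.mem_univ i)]
  congr 1
  · simp
  · refine Finset.prod_congr rfl fun j hj => ?_
    rw [Function.update_of_ne (Finset.ne_of_mem_erase hj)]

lemma eec_memLp {d : ℕ} (μ : Fin d → Measure ℝ) [∀ i, IsFiniteMeasure (μ i)]
    (r : Fin d → ℝ → ℝ) (hr : ∀ i, MemLp (r i) 2 (μ i)) (i : Fin d) (s : ℝ → ℝ)
    (hs : MemLp s 2 (μ i)) :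
    MemLp (fun x : Fin d → ℝ => s (x i) * ∏ j ∈ Finset.univ.erase i, r j (x j)) 2
      (Measure.pi μ) := by
  simp_rw [← eec_upd]
  refine eec_memLp_prod μ _ fun j => ?_
  by_cases h : j = i
  · subst h; simpa using hs
  · simpa [h] using hr j

lemma eec_A {d : ℕ} (μ : Fin d → Measure ℝ) [∀ i, IsFiniteMeasure (μ i)]
    (r : Fin d → ℝ → ℝ) (i : Fin d) (s : ℝ → ℝ) :
    ∫ x, (∏ j, r j (x j)) * (s (x i) * ∏ j ∈ Finset.univ.erase i, r j (x j)) ∂(Measure.pi μ) =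
    ∫ t, s t * ((∏ j ∈ Finset.univ.erase i, ∫ t, (r j t) ^ 2 ∂(μ j)) * r i t) ∂(μ i) := by
  simp_rw [← eec_upd, ← Finset.prod_mul_distrib]
  rw [integral_fintype_prod_eq_prod (fun j t => r j t * Function.update r i s j t),
    ← Finset.mul_prod_erase _ _ (Finset.mem_univ i), mul_comm, ← integral_const_mul]
  simp only [Function.update_self]
  have : ∏ j ∈ Finset.univ.erase i, ∫ t, r j t * Function.update r i s j t ∂(μ j) =
      ∏ j ∈ Finset.univ.erase i, ∫ t, (r j t) ^ 2 ∂(μ j) := by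
    refine Finset.prod_congr rfl fun j hj => ?_
    rw [Function.update_of_ne (Finset.ne_of_mem_erase hj)]
    simp [sq]
  rw [this]
  congr 1
  ext t
  ring

lemma eec_B {d : ℕ} (μ : Fin d → Measure ℝ) [∀ i, IsFiniteMeasure (μ i)]
    (g : (Fin d → ℝ) → ℝ) (hg : MemLp g 2 (Measure.pi μ))
    (r : Fin d → ℝ → ℝ) (hr : ∀ i, MemLp (r i) 2 (μ i)) (i : Fin d) (s : ℝ → ℝ)
    (hs : MemLp s 2 (μ i)) :
    Integrable (fun t => s t * ∫ y, (∏ j : {j : Fin d // j ≠ i}, r (j : Fin d) (y j)) *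
            g (fun j => if h : j = i then t else y ⟨j, h⟩)
          ∂(Measure.pi fun j : {j : Fin d // j ≠ i} => μ (j : Fin d))) (μ i) ∧
    ∫ x, g x * (s (x i) * ∏ j ∈ Finset.univ.erase i, r j (x j)) ∂(Measure.pi μ) =
    ∫ t, s t * ∫ y, (∏ j : {j : Fin d // j ≠ i}, r (j : Fin d) (y j)) *
            g (fun j => if h : j = i then t else y ⟨j, h⟩)
          ∂(Measure.pi fun j : {j : Fin d // j ≠ i} => μ (j : Fin d)) ∂(μ i) := by
  have hint : Integrable (fun x => g x * (s (x i) * ∏ j ∈ Finset.univ.erase i, r j (x j)))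
      (Measure.pi μ) := hg.integrable_mul (eec_memLp μ r hr i s hs)
  have mp := eec_mp μ i
  have h1 := mp.integrable_comp_of_integrable hint
  have key : ((fun x => g x * (s (x i) * ∏ j ∈ Finset.univ.erase i, r j (x j))) ∘
      (fun (p : ℝ × ({j : Fin d // j ≠ i} → ℝ)) (j : Fin d) =>
      if h : j = i then p.1 else p.2 ⟨j, h⟩)) = fun p =>
      s p.1 * ((∏ j : {j : Fin d // j ≠ i}, r (j : Fin d) (p.2 j)) *
            g (fun j => if h : j = i then p.1 else p.2 ⟨j, h⟩)) := by
    ext p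
    simp only [Function.comp]
    rw [Finset.prod_subtype (Finset.univ.erase i) (p := fun j => j ≠ i) (by simp)]
    have : ∏ a : {j : Fin d // j ≠ i}, r (a : Fin d) (if h : (a : Fin d) = i then p.1 else p.2 ⟨a, h⟩)
      = ∏ j : {j : Fin d // j ≠ i}, r (j : Fin d) (p.2 j) :=
      Finset.prod_congr rfl fun a _ => by simp [a.2]
    rw [this]
    simp only [dite_true]
    ring
  have h2 : ∫ x, g x * (s (x i) * ∏ j ∈ Finset.univ.erase i, r j (x j)) ∂(Measure.pi μ) =
      ∫ p : ℝ × ({j : Fin d // j ≠ i} → ℝ),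
        s p.1 * ((∏ j : {j : Fin d // j ≠ i}, r (j : Fin d) (p.2 j)) *
            g (fun j => if h : j = i then p.1 else p.2 ⟨j, h⟩))
        ∂((μ i).prod (Measure.pi fun j : {j : Fin d // j ≠ i} => μ j)) := by
    rw [← mp.map_eq, integral_map mp.aemeasurable (by rw [mp.map_eq]; exact hint.aestronglyMeasurable)]
    exact congrArg (fun f => ∫ p, f p ∂((μ i).prod (Measure.pi fun j : {j : Fin d // j ≠ i} => μ j))) key
  rw [key] at h1
  constructor
  · have := h1.integral_prod_left
    simpa only [integral_const_mul] using this
  · rw [h2]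
    rw [integral_prod _ h1]
    simp only [integral_const_mul]

lemma eec_main {d : ℕ} (μ : Fin d → Measure ℝ) [∀ i, IsFiniteMeasure (μ i)]
    (g : (Fin d → ℝ) → ℝ) (hg : MemLp g 2 (Measure.pi μ))
    (r : Fin d → ℝ → ℝ) (hr : ∀ i, MemLp (r i) 2 (μ i)) :
    (∀ s : ∀ _ : Fin d, ℝ → ℝ, (∀ i, MemLp (s i) 2 (μ i)) →
      ∫ x, (∏ j, r j (x j)) *
          (∑ i, s i (x i) * ∏ j ∈ Finset.univ.erase i, r j (x j))
          ∂(Measure.pi μ) =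
        ∫ x, g x * (∑ i, s i (x i) * ∏ j ∈ Finset.univ.erase i, r j (x j))
          ∂(Measure.pi μ))
    ↔
    (∀ i : Fin d, ∀ᵐ xi ∂(μ i),
      (∏ j ∈ Finset.univ.erase i, ∫ t, (r j t) ^ 2 ∂(μ j)) * r i xi =
        ∫ y, (∏ j : {j : Fin d // j ≠ i}, r (j : Fin d) (y j)) *
            g (fun j => if h : j = i then xi else y ⟨j, h⟩)
          ∂(Measure.pi fun j : {j : Fin d // j ≠ i} => μ (j : Fin d))) := by
  have sumA : ∀ s : Fin d → ℝ → ℝ, (∀ i, MemLp (s i) 2 (μ i)) →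
      ∫ x, (∏ j, r j (x j)) * (∑ i, s i (x i) * ∏ j ∈ Finset.univ.erase i, r j (x j))
        ∂(Measure.pi μ) = ∑ i, ∫ t, s i t *
        ((∏ j ∈ Finset.univ.erase i, ∫ t, (r j t) ^ 2 ∂(μ j)) * r i t) ∂(μ i) := by
    intro s hs
    simp_rw [Finset.mul_sum]
    rw [integral_finsetSum]
    swap
    · exact fun i _ =>
        (eec_memLp_prod μ r hr).integrable_mul (eec_memLp μ r hr i (s i) (hs i))
    exact Finset.sum_congr rfl fun i _ => eec_A μ r i (s i)
  have sumB : ∀ s : Fin d → ℝ → ℝ, (∀ i, MemLp (s i) 2 (μ i)) →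
      ∫ x, g x * (∑ i, s i (x i) * ∏ j ∈ Finset.univ.erase i, r j (x j))
        ∂(Measure.pi μ) = ∑ i, ∫ t, s i t *
        ∫ y, (∏ j : {j : Fin d // j ≠ i}, r (j : Fin d) (y j)) *
            g (fun j => if h : j = i then t else y ⟨j, h⟩)
          ∂(Measure.pi fun j : {j : Fin d // j ≠ i} => μ (j : Fin d)) ∂(μ i) := by
    intro s hs
    simp_rw [Finset.mul_sum]
    rw [integral_finsetSum]
    swap
    · exact fun i _ => hg.integrable_mul (eec_memLp μ r hr i (s i) (hs i))
    exact Finset.sum_congr rfl fun i _ => (eec_B μ g hg r hr i (s i) (hs i)).2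
  constructor
  · intro H i
    have i2 := (eec_B μ g hg r hr i (fun _ => 1) (memLp_const 1)).1
    simp only [one_mul] at i2
    have i1 : Integrable (fun t => (∏ j ∈ Finset.univ.erase i, ∫ t, (r j t) ^ 2 ∂(μ j)) * r i t)
        (μ i) := ((hr i).integrable (by norm_num)).const_mul _
    refine Integrable.ae_eq_of_forall_setIntegral_eq _ _ i1 i2 fun S hS _ => ?_
    let s : Fin d → ℝ → ℝ := fun j => if j = i then S.indicator (fun _ => 1) else fun _ => 0
    have hs : ∀ j, MemLp (s j) 2 (μ j) := by
      intro j
      by_cases h : j = i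
      · simp only [s, h, if_true]
        exact (memLp_const 1).indicator hS
      · simp only [s, h, if_false]
        exact memLp_const 0
    have h := H s hs
    rw [sumA s hs, sumB s hs, Finset.sum_eq_single i, Finset.sum_eq_single i] at h
    · rw [← integral_indicator hS, ← integral_indicator hS]
      simp only [s, if_true] at h
      have ind : ∀ f : ℝ → ℝ, S.indicator f = fun t => S.indicator (fun _ => (1 : ℝ)) t * f t := by
        intro f
        ext t
        by_cases ht : t ∈ S <;> simp [ht]
      rw [ind, ind (fun t => ∫ y, _ ∂_)]
      exact h
    · intro j _ hj
      simp [s, hj]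
    · simp
    · intro j _ hj
      simp [s, hj]
    · simp
  · intro H s hs
    rw [sumA s hs, sumB s hs]
    refine Finset.sum_congr rfl fun i _ => integral_congr_ae ?_
    filter_upwards [H i] with t ht
    rw [ht]

/-- The Euler equation of the greedy step for the approximation of a square-integrable
function `g` on `Ω₁ × ⋯ × Ω_d`: the tuple `(r¹, …, r^d)` satisfies the variational Euler
equation against all tuples of test functions iff, for each coordinate `i`, the function
`(∏_{j≠i} ‖r^j‖²_{L²}) rⁱ` coincides almost everywhere with the partial integral of
`(⊗_{j≠i} r^j) g` over the remaining coordinates. -/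
theorem euler_equation_characterization
    {d : ℕ} (hd : 1 ≤ d) (Ω : Fin d → Set ℝ)
    (hmeas : ∀ i, MeasurableSet (Ω i)) (hbdd : ∀ i, Bornology.IsBounded (Ω i))
    (g : (Fin d → ℝ) → ℝ)
    (hg : MemLp g 2 (Measure.pi fun i => volume.restrict (Ω i)))
    (r : ∀ _ : Fin d, ℝ → ℝ)
    (hr : ∀ i, MemLp (r i) 2 (volume.restrict (Ω i))) :
    (∀ s : ∀ _ : Fin d, ℝ → ℝ, (∀ i, MemLp (s i) 2 (volume.restrict (Ω i))) →
      ∫ x, (∏ j, r j (x j)) *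
          (∑ i, s i (x i) * ∏ j ∈ Finset.univ.erase i, r j (x j))
          ∂(Measure.pi fun i => volume.restrict (Ω i)) =
        ∫ x, g x * (∑ i, s i (x i) * ∏ j ∈ Finset.univ.erase i, r j (x j))
          ∂(Measure.pi fun i => volume.restrict (Ω i)))
    ↔
    (∀ i : Fin d, ∀ᵐ xi ∂(volume.restrict (Ω i)),
      (∏ j ∈ Finset.univ.erase i, ∫ t, (r j t) ^ 2 ∂(volume.restrict (Ω j))) * r i xi =
        ∫ y, (∏ j : {j : Fin d // j ≠ i}, r (j : Fin d) (y j)) *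
            g (fun j => if h : j = i then xi else y ⟨j, h⟩)
          ∂(Measure.pi fun j : {j : Fin d // j ≠ i} => volume.restrict (Ω (j : Fin d)))) := by
  have : ∀ i, IsFiniteMeasure (volume.restrict (Ω i)) := fun i =>
    ⟨by simpa using (hbdd i).measure_lt_top⟩
  exact eec_main (fun i => volume.restrict (Ω i)) g hg r hr
end

section
/- The bilinear form b̃ is continuous with respect to the norm ‖·‖_𝒱: there exists a constant c̄ > 0, depending only on d, (σ_i), (ρ_{ij}) and r, such that for all v, w ∈ C_c^∞(Ω), |b̃(v,w)| ≤ c̄ ‖v‖_𝒱 ‖w‖_𝒱. -/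
open MeasureTheory

/-- Partial derivative in the `i`-th coordinate direction. -/
noncomputable def pd {d : ℕ} (f : (Fin d → ℝ) → ℝ) (i : Fin d) (x : Fin d → ℝ) : ℝ :=
  fderiv ℝ f x (Pi.single i 1)

/-- The open unit cube `Ω = (0,1)^d`. -/
def cube (d : ℕ) : Set (Fin d → ℝ) := Set.univ.pi fun _ => Set.Ioo (0 : ℝ) 1

/-- The diffusion matrix `A_{ij}(x) = (ρ_{ij} σ_i σ_j / 2) x_i x_j (1-x_i)(1-x_j)`. -/
noncomputable def Amat {d : ℕ} (σ : Fin d → ℝ) (ρ : Fin d → Fin d → ℝ)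
    (i j : Fin d) (x : Fin d → ℝ) : ℝ :=
  ρ i j * σ i * σ j / 2 * (x i * x j * (1 - x i) * (1 - x j))

/-- `ã_i(x) = r + σ_i² x_i - σ_i² + (σ_i/2) ∑_{j≠i} ρ_{ij} σ_j (2x_j - 1)`. -/
noncomputable def atilde {d : ℕ} (σ : Fin d → ℝ) (ρ : Fin d → Fin d → ℝ) (r : ℝ)
    (i : Fin d) (x : Fin d → ℝ) : ℝ :=
  r + σ i ^ 2 * x i - σ i ^ 2 +
    σ i / 2 * ∑ j ∈ Finset.univ.erase i, ρ i j * σ j * (2 * x j - 1)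

/-- The drift vector field `a_i(x) = x_i (1-x_i) ã_i(x)`. -/
noncomputable def avec {d : ℕ} (σ : Fin d → ℝ) (ρ : Fin d → Fin d → ℝ) (r : ℝ)
    (i : Fin d) (x : Fin d → ℝ) : ℝ :=
  x i * (1 - x i) * atilde σ ρ r i x

/-- The square of the seminorm `|v|_𝒱² = ∑_i ∫_Ω |x_i (1-x_i) ∂v/∂x_i|²`. -/
noncomputable def Vsemisq {d : ℕ} (v : (Fin d → ℝ) → ℝ) : ℝ :=
  ∑ i, ∫ x in cube d, (x i * (1 - x i) * pd v i x) ^ 2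

/-- The norm `‖v‖_𝒱 = (‖v‖²_{L²(Ω)} + |v|_𝒱²)^{1/2}`. -/
noncomputable def Vnorm {d : ℕ} (v : (Fin d → ℝ) → ℝ) : ℝ :=
  Real.sqrt ((∫ x in cube d, (v x) ^ 2) + Vsemisq v)

/-- The bilinear form `b̃(v,w) = ∫_Ω (A∇v)·∇w - ∫_Ω (a·∇v) w + r ∫_Ω v w`. -/
noncomputable def btilde {d : ℕ} (σ : Fin d → ℝ) (ρ : Fin d → Fin d → ℝ) (r : ℝ)
    (v w : (Fin d → ℝ) → ℝ) : ℝ :=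
  (∫ x in cube d, ∑ i, (∑ j, Amat σ ρ i j x * pd v j x) * pd w i x)
    - (∫ x in cube d, (∑ i, avec σ ρ r i x * pd v i x) * w x)
    + r * ∫ x in cube d, v x * w x

/-- `v ∈ C_c^∞(Ω)`: smooth, compactly supported, with support inside `Ω = (0,1)^d`. -/
def IsTestFun {d : ℕ} (v : (Fin d → ℝ) → ℝ) : Prop :=
  ContDiff ℝ (⊤ : ℕ∞) v ∧ HasCompactSupport v ∧ tsupport v ⊆ cube d

noncomputable def Ndens {d : ℕ} (v : (Fin d → ℝ) → ℝ) (x : Fin d → ℝ) : ℝ :=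
  v x ^ 2 + ∑ i, (x i * (1 - x i) * pd v i x) ^ 2

lemma Ndens_nonneg {d : ℕ} (v : (Fin d → ℝ) → ℝ) (x : Fin d → ℝ) : 0 ≤ Ndens v x := by
  unfold Ndens; positivity

lemma pd_cont {d : ℕ} {v : (Fin d → ℝ) → ℝ} (hv : IsTestFun v) (i : Fin d) :
    Continuous (pd v i) := by
  have h := hv.1.continuous_fderiv (by simp)
  unfold pd
  fun_prop

lemma cont_integrable {d : ℕ} {f : (Fin d → ℝ) → ℝ} (hf : Continuous f) :
    IntegrableOn f (cube d) := by
  have h : IntegrableOn f (Set.Icc (0 : Fin d → ℝ) 1) := hf.continuousOn.integrableOn_Icc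
  refine h.mono_set ?_
  intro x hx
  have hx' : ∀ i, x i ∈ Set.Ioo (0:ℝ) 1 := fun i => hx i (Set.mem_univ i)
  exact ⟨fun i => (hx' i).1.le, fun i => (hx' i).2.le⟩

lemma Ndens_cont {d : ℕ} {v : (Fin d → ℝ) → ℝ} (hv : IsTestFun v) :
    Continuous (Ndens v) := by
  have h := fun i => pd_cont hv i
  have h0 := hv.1.continuous
  unfold Ndens
  fun_prop

lemma Vnorm_eq {d : ℕ} {v : (Fin d → ℝ) → ℝ} (hv : IsTestFun v) :
    Vnorm v = Real.sqrt (∫ x in cube d, Ndens v x) := by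
  have h := fun i => pd_cont hv i
  have h0 := hv.1.continuous
  unfold Vnorm Vsemisq Ndens
  rw [integral_add, integral_finsetSum]
  · intro i _
    exact cont_integrable (by fun_prop)
  · exact cont_integrable (by fun_prop)
  · exact cont_integrable (by fun_prop)

lemma abs_v_le {d : ℕ} (v : (Fin d → ℝ) → ℝ) (x : Fin d → ℝ) :
    |v x| ≤ Real.sqrt (Ndens v x) := by
  apply Real.abs_le_sqrt
  unfold Ndens
  have : 0 ≤ ∑ i, (x i * (1 - x i) * pd v i x) ^ 2 := by positivity
  linarith

lemma abs_phi_le {d : ℕ} (v : (Fin d → ℝ) → ℝ) (x : Fin d → ℝ) (i : Fin d) :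
    |x i * (1 - x i) * pd v i x| ≤ Real.sqrt (Ndens v x) := by
  apply Real.abs_le_sqrt
  unfold Ndens
  have := Finset.single_le_sum (f := fun i => (x i * (1 - x i) * pd v i x) ^ 2)
    (fun i _ => sq_nonneg _) (Finset.mem_univ i)
  have h2 := sq_nonneg (v x)
  linarith

lemma cs {d : ℕ} {v w : (Fin d → ℝ) → ℝ} (hv : IsTestFun v) (hw : IsTestFun w) :
    ∫ x in cube d, Real.sqrt (Ndens v x) * Real.sqrt (Ndens w x) ≤ Vnorm v * Vnorm w := by
  have key : ∀ u : (Fin d → ℝ) → ℝ, IsTestFun u →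
      MemLp (fun x => Real.sqrt (Ndens u x)) (ENNReal.ofReal 2) (volume.restrict (cube d)) := by
    intro u hu
    have hc := Ndens_cont hu
    have h2 : (ENNReal.ofReal 2) = 2 := by simp
    rw [h2, memLp_two_iff_integrable_sq]
    · simp only [Real.sq_sqrt (Ndens_nonneg u _)]
      exact cont_integrable hc
    · exact (by fun_prop : Continuous fun x => Real.sqrt (Ndens u x)).aestronglyMeasurable
  have h := integral_mul_le_Lp_mul_Lq_of_nonneg (μ := volume.restrict (cube d))
    Real.HolderConjugate.two_two
    (Filter.Eventually.of_forall fun x => Real.sqrt_nonneg (Ndens v x))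
    (Filter.Eventually.of_forall fun x => Real.sqrt_nonneg (Ndens w x)) (key v hv) (key w hw)
  rw [Vnorm_eq hv, Vnorm_eq hw]
  simp only [Real.rpow_two, Real.sq_sqrt (Ndens_nonneg _ _), ← Real.sqrt_eq_rpow] at h
  exact h

lemma bound_int {d : ℕ} {v w : (Fin d → ℝ) → ℝ} (hv : IsTestFun v) (hw : IsTestFun w)
    (f : (Fin d → ℝ) → ℝ) (C : ℝ) (hC : 0 ≤ C)
    (hf : ∀ x ∈ cube d, |f x| ≤ C * (Real.sqrt (Ndens v x) * Real.sqrt (Ndens w x))) :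
    |∫ x in cube d, f x| ≤ C * (Vnorm v * Vnorm w) := by
  have hcv := Ndens_cont hv
  have hcw := Ndens_cont hw
  have hm : MeasurableSet (cube d) := MeasurableSet.univ_pi fun _ => measurableSet_Ioo
  have h1 : ‖∫ x in cube d, f x‖ ≤
      ∫ x in cube d, C * (Real.sqrt (Ndens v x) * Real.sqrt (Ndens w x)) := by
    apply norm_integral_le_of_norm_le
    · exact cont_integrable (by fun_prop)
    · filter_upwards [ae_restrict_mem hm] with x hx
      exact hf x hx
  rw [integral_const_mul] at h1
  exact h1.trans (mul_le_mul_of_nonneg_left (cs hv hw) hC)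

lemma atilde_bound {d : ℕ} (σ : Fin d → ℝ) (ρ : Fin d → Fin d → ℝ) (r : ℝ) (i : Fin d)
    (x : Fin d → ℝ) (hx : x ∈ cube d) :
    |atilde σ ρ r i x| ≤ |r| + σ i ^ 2 +
      |σ i / 2| * ∑ j ∈ Finset.univ.erase i, |ρ i j * σ j| := by
  have hx' : ∀ i, x i ∈ Set.Ioo (0:ℝ) 1 := fun i => hx i (Set.mem_univ i)
  unfold atilde
  have e : r + σ i ^ 2 * x i - σ i ^ 2 +
    σ i / 2 * ∑ j ∈ Finset.univ.erase i, ρ i j * σ j * (2 * x j - 1) =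
    (r + σ i ^ 2 * (x i - 1)) +
    σ i / 2 * ∑ j ∈ Finset.univ.erase i, ρ i j * σ j * (2 * x j - 1) := by ring
  rw [e]
  refine (abs_add_le _ _).trans (add_le_add ((abs_add_le _ _).trans (add_le_add le_rfl ?_)) ?_)
  · rw [abs_mul, abs_of_nonneg (sq_nonneg (σ i))]
    refine mul_le_of_le_one_right (sq_nonneg _) ?_
    rw [abs_le]; constructor <;> linarith [(hx' i).1, (hx' i).2]
  · rw [abs_mul]
    refine mul_le_mul_of_nonneg_left ?_ (abs_nonneg _)
    refine (Finset.abs_sum_le_sum_abs _ _).trans (Finset.sum_le_sum fun j _ => ?_)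
    rw [abs_mul]
    refine mul_le_of_le_one_right (abs_nonneg _) ?_
    rw [abs_le]; constructor <;> linarith [(hx' j).1, (hx' j).2]

/-- Continuity of the bilinear form `b̃` with respect to the norm `‖·‖_𝒱`. -/
theorem btilde_continuous
    {d : ℕ} (hd : 1 ≤ d) (σ : Fin d → ℝ) (hσ : ∀ i, 0 < σ i)
    (ρ : Fin d → Fin d → ℝ) (hρsymm : ∀ i j, ρ i j = ρ j i) (hρdiag : ∀ i, ρ i i = 1)
    (r : ℝ) (hr : 0 ≤ r) :
    ∃ cbar : ℝ, 0 < cbar ∧ ∀ v w : (Fin d → ℝ) → ℝ, IsTestFun v → IsTestFun w →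
      |btilde σ ρ r v w| ≤ cbar * Vnorm v * Vnorm w := by
  set C1 : ℝ := ∑ i, ∑ j, |ρ i j * σ i * σ j / 2| with hC1
  set C2 : ℝ := ∑ i, (|r| + σ i ^ 2 +
      |σ i / 2| * ∑ j ∈ Finset.univ.erase i, |ρ i j * σ j|) with hC2
  have p1 : 0 ≤ C1 := by positivity
  have p2 : 0 ≤ C2 := by positivity
  refine ⟨C1 + C2 + r + 1, by positivity, fun v w hv hw => ?_⟩
  have b1 := bound_int hv hw
    (fun x => ∑ i, (∑ j, Amat σ ρ i j x * pd v j x) * pd w i x) C1 p1 (by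
      intro x _
      simp only [hC1, Finset.sum_mul]
      refine (Finset.abs_sum_le_sum_abs _ _).trans (Finset.sum_le_sum fun i _ => ?_)
      refine (Finset.abs_sum_le_sum_abs _ _).trans (Finset.sum_le_sum fun j _ => ?_)
      have e : Amat σ ρ i j x * pd v j x * pd w i x = (ρ i j * σ i * σ j / 2) *
          ((x j * (1 - x j) * pd v j x) * (x i * (1 - x i) * pd w i x)) := by
        unfold Amat; ring
      rw [e, abs_mul, abs_mul (x j * (1 - x j) * pd v j x)]
      exact mul_le_mul_of_nonneg_left (mul_le_mul (abs_phi_le v x j) (abs_phi_le w x i)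
        (abs_nonneg _) (Real.sqrt_nonneg _)) (abs_nonneg _))
  have b2 := bound_int hv hw
    (fun x => (∑ i, avec σ ρ r i x * pd v i x) * w x) C2 p2 (by
      intro x hx
      simp only [hC2, Finset.sum_mul]
      refine (Finset.abs_sum_le_sum_abs _ _).trans (Finset.sum_le_sum fun i _ => ?_)
      have e : avec σ ρ r i x * pd v i x * w x = atilde σ ρ r i x *
          ((x i * (1 - x i) * pd v i x) * w x) := by
        unfold avec; ring
      rw [e, abs_mul, abs_mul (x i * (1 - x i) * pd v i x)]
      exact mul_le_mul (atilde_bound σ ρ r i x hx) (mul_le_mul (abs_phi_le v x i) (abs_v_le w x)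
        (abs_nonneg _) (Real.sqrt_nonneg _)) (by positivity) (by positivity))
  have b3 := bound_int hv hw (fun x => v x * w x) 1 zero_le_one (by
      intro x _
      rw [one_mul, abs_mul]
      exact mul_le_mul (abs_v_le v x) (abs_v_le w x) (abs_nonneg _) (Real.sqrt_nonneg _))
  have b3' : |r * ∫ x in cube d, v x * w x| ≤ r * (Vnorm v * Vnorm w) := by
    rw [abs_mul, abs_of_nonneg hr]
    exact mul_le_mul_of_nonneg_left (by simpa using b3) hr
  have p : 0 ≤ Vnorm v * Vnorm w := mul_nonneg (Real.sqrt_nonneg _) (Real.sqrt_nonneg _)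
  unfold btilde
  refine (abs_add_le _ _).trans ?_
  refine (add_le_add (abs_sub _ _) le_rfl).trans ?_
  linarith
end
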